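/- arXiv:2002.02508 — 2 statements merged into one kernel-verified Lean document; each statement's English description precedes it below -/
import Mathlib

section
/- Linear contraction factor of DQ-GD (Theorem 1, per-instance form). Under the DQ-GD algorithm with D > 0, the iterates satisfy limsup_{T→∞} ‖x̂_T − x*‖^{1/T} ≤ max{σ_GD, ε}. -/
open Filter Topology

section GradientDescent

variable {F : Type*} [NormedAddCommGroup F] [InnerProductSpace ℝ F] [CompleteSpace F]

lemma HasGradientAt.hasDerivAt_comp_add_smul {f : F → ℝ} {g x d : F} {t : ℝ}
    (h : HasGradientAt f g (x + t • d)) :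
    HasDerivAt (fun s : ℝ => f (x + s • d)) (inner ℝ g d) t := by
  have hline : HasDerivAt (fun s : ℝ => x + s • d) d t := by
    simpa using ((hasDerivAt_id t).smul_const d).const_add x
  exact (h.hasFDerivAt.comp_hasDerivAt t hline).congr_deriv
    (InnerProductSpace.toDual_apply_apply ..)

/-- The descent lemma: the quadratic upper bound for a function with Lipschitz gradient. -/
lemma le_add_inner_add_of_lipschitz_gradient {f : F → ℝ} {L : ℝ} (hf : Differentiable ℝ f)
    (hsmooth : ∀ x y, ‖gradient f x - gradient f y‖ ≤ L * ‖x - y‖) (x d : F) :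
    f (x + d) ≤ f x + inner ℝ (gradient f x) d + L / 2 * ‖d‖ ^ 2 := by
  have hderiv (t : ℝ) : HasDerivAt
      (fun s : ℝ => f (x + s • d) - s * inner ℝ (gradient f x) d - s ^ 2 * (L / 2 * ‖d‖ ^ 2))
      (inner ℝ (gradient f (x + t • d)) d - inner ℝ (gradient f x) d - t * L * ‖d‖ ^ 2) t := by
    have h₁ := (hf (x + t • d)).hasGradientAt.hasDerivAt_comp_add_smul
    have h₂ := (hasDerivAt_id t).mul_const (inner ℝ (gradient f x) d)
    have h₃ := (hasDerivAt_pow 2 t).mul_const (L / 2 * ‖d‖ ^ 2)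
    refine ((h₁.sub h₂).sub h₃).congr_deriv ?_
    push_cast
    ring
  have hanti := antitoneOn_of_deriv_nonpos (convex_Icc (0 : ℝ) 1)
    (fun t _ => (hderiv t).continuousAt.continuousWithinAt)
    (fun t _ => (hderiv t).differentiableAt.differentiableWithinAt) (fun t ht => by
      rw [interior_Icc] at ht
      rw [(hderiv t).deriv, ← inner_sub_left]
      have hlip := hsmooth (x + t • d) x
      rw [add_sub_cancel_left, norm_smul, Real.norm_of_nonneg ht.1.le] at hlip
      nlinarith [real_inner_le_norm (gradient f (x + t • d) - gradient f x) d,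
        mul_le_mul_of_nonneg_right hlip (norm_nonneg d)])
  have h := hanti (Set.left_mem_Icc.2 zero_le_one) (Set.right_mem_Icc.2 zero_le_one) zero_le_one
  simp only [one_smul, zero_smul, add_zero] at h
  linarith

/-- The quadratic lower bound for a differentiable strongly convex function. -/
lemma add_inner_add_le_of_convexOn_sub {f : F → ℝ} {μ : ℝ} (hf : Differentiable ℝ f)
    (hconv : ConvexOn ℝ Set.univ (fun x : F => f x - μ / 2 * ‖x‖ ^ 2)) (x d : F) :
    f x + inner ℝ (gradient f x) d + μ / 2 * ‖d‖ ^ 2 ≤ f (x + d) := by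
  have hnorm (t : ℝ) : ‖x + t • d‖ ^ 2 = ‖x‖ ^ 2 + t * (2 * inner ℝ x d) + t ^ 2 * ‖d‖ ^ 2 := by
    rw [norm_add_sq_real, inner_smul_right, norm_smul, mul_pow, Real.norm_eq_abs, sq_abs]
    ring
  have hline : ConvexOn ℝ Set.univ
      (fun t : ℝ => f (x + t • d) - μ / 2 * ‖x + t • d‖ ^ 2) := by
    have h := hconv.comp_affineMap (AffineMap.lineMap x (x + d) : ℝ →ᵃ[ℝ] F)
    simpa [Function.comp_def, AffineMap.lineMap_apply, add_comm] using h
  have hderiv : HasDerivAt (fun t : ℝ => f (x + t • d) - μ / 2 * ‖x + t • d‖ ^ 2)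
      (inner ℝ (gradient f x) d - μ * inner ℝ x d) 0 := by
    have h₁ : HasDerivAt (fun t : ℝ => f (x + t • d)) (inner ℝ (gradient f x) d) 0 :=
      HasGradientAt.hasDerivAt_comp_add_smul (by simpa using (hf x).hasGradientAt)
    have h₂ := (((hasDerivAt_id (0 : ℝ)).mul_const (2 * inner ℝ x d)).const_add (‖x‖ ^ 2)).add
      ((hasDerivAt_pow 2 (0 : ℝ)).mul_const (‖d‖ ^ 2))
    simp only [hnorm]
    refine (h₁.sub (h₂.const_mul (μ / 2))).congr_deriv ?_
    push_cast
    ring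
  have h := hline.le_slope_of_hasDerivAt (Set.mem_univ 0) (Set.mem_univ 1) zero_lt_one hderiv
  rw [slope_def_field] at h
  have hone := hnorm 1
  simp only [one_smul] at hone
  simp only [one_smul, zero_smul, add_zero, sub_zero, div_one, hone] at h
  linarith

/-- Co-coercivity of the gradient of `f - μ / 2 * ‖·‖ ^ 2`. -/
lemma norm_sq_gradient_sub_le {f : F → ℝ} {L μ : ℝ} (hμL : μ ≤ L) (hf : Differentiable ℝ f)
    (hsmooth : ∀ x y, ‖gradient f x - gradient f y‖ ≤ L * ‖x - y‖)
    (hconv : ConvexOn ℝ Set.univ (fun x : F => f x - μ / 2 * ‖x‖ ^ 2)) (x y : F) :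
    ‖gradient f x - gradient f y - μ • (x - y)‖ ^ 2
      ≤ (L - μ) * inner ℝ (gradient f x - gradient f y - μ • (x - y)) (x - y) := by
  have hhalf (x y : F) (s : ℝ) :
      f x - f y - inner ℝ (gradient f x) (x - y) + μ / 2 * ‖x - y‖ ^ 2
        + (s - (L - μ) / 2 * s ^ 2) * ‖gradient f x - gradient f y - μ • (x - y)‖ ^ 2 ≤ 0 := by
    obtain ⟨d, rfl⟩ : ∃ d, x = y + d := ⟨x - y, by abel⟩
    rw [add_sub_cancel_left]
    set w := gradient f (y + d) - gradient f y - μ • d with hw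
    have hup := le_add_inner_add_of_lipschitz_gradient hf hsmooth y (s • w)
    have hlow := add_inner_add_le_of_convexOn_sub hf hconv (y + d) (s • w - d)
    have hww : inner ℝ (gradient f (y + d)) w
        = ‖w‖ ^ 2 + inner ℝ (gradient f y) w + μ * inner ℝ w d := by
      have : gradient f (y + d) = w + gradient f y + μ • d := by rw [hw]; abel
      rw [this, inner_add_left, inner_add_left, real_inner_self_eq_norm_sq, real_inner_smul_left,
        real_inner_comm d w]
    rw [show y + d + (s • w - d) = y + s • w by abel, norm_sub_sq_real, inner_sub_right] at hlow
    simp only [real_inner_smul_left, real_inner_smul_right, norm_smul, mul_pow,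
      Real.norm_eq_abs, sq_abs] at hup hlow
    rw [hww] at hlow
    linarith
  have hsum (s : ℝ) :
      (2 * s - (L - μ) * s ^ 2) * ‖gradient f x - gradient f y - μ • (x - y)‖ ^ 2
        ≤ inner ℝ (gradient f x - gradient f y - μ • (x - y)) (x - y) := by
    have h₁ := hhalf x y s
    have h₂ := hhalf y x s
    have hneg : gradient f y - gradient f x - μ • (y - x)
        = -(gradient f x - gradient f y - μ • (x - y)) := by
      rw [← neg_sub x y, smul_neg]; abel
    rw [hneg, norm_neg, norm_sub_rev y x, ← neg_sub x y, inner_neg_right] at h₂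
    rw [inner_sub_left, inner_sub_left, real_inner_smul_left, real_inner_self_eq_norm_sq]
    linarith
  rcases hμL.eq_or_lt with rfl | hlt
  · set N := ‖gradient f x - gradient f y - μ • (x - y)‖ ^ 2
    set c := inner ℝ (gradient f x - gradient f y - μ • (x - y)) (x - y)
    rw [sub_self, zero_mul]
    by_contra! hpos
    have h := hsum ((c + 1) / (2 * N))
    rw [sub_self, zero_mul, sub_zero, show 2 * ((c + 1) / (2 * N)) * N = c + 1 by
      field_simp] at h
    linarith
  · have hK : 0 < L - μ := sub_pos.2 hlt
    have h := hsum (1 / (L - μ))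
    rw [show 2 * (1 / (L - μ)) - (L - μ) * (1 / (L - μ)) ^ 2 = 1 / (L - μ) by
      field_simp; ring, one_div, inv_mul_le_iff₀ hK] at h
    exact h

/-- The gradient step of length `2 / (L + μ)` is a contraction with factor `(L - μ) / (L + μ)`. -/
lemma norm_gradient_step_sub_le {f : F → ℝ} {L μ : ℝ} (hμ : 0 < μ) (hμL : μ ≤ L)
    (hf : Differentiable ℝ f)
    (hsmooth : ∀ x y, ‖gradient f x - gradient f y‖ ≤ L * ‖x - y‖)
    (hconv : ConvexOn ℝ Set.univ (fun x : F => f x - μ / 2 * ‖x‖ ^ 2)) (x y : F) :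
    ‖x - (2 / (L + μ)) • gradient f x - (y - (2 / (L + μ)) • gradient f y)‖
      ≤ (L - μ) / (L + μ) * ‖x - y‖ := by
  have hS : 0 < L + μ := by linarith
  have hK : 0 ≤ L - μ := sub_nonneg.2 hμL
  have hco := norm_sq_gradient_sub_le hμL hf hsmooth hconv x y
  set w := gradient f x - gradient f y - μ • (x - y) with hw
  have hstep : x - (2 / (L + μ)) • gradient f x - (y - (2 / (L + μ)) • gradient f y)
      = (L + μ)⁻¹ • ((L - μ) • (x - y) - (2 : ℝ) • w) := by
    rw [hw]
    match_scalars <;> field_simp <;> ring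
  have hnorm : ‖(L - μ) • (x - y) - (2 : ℝ) • w‖ ≤ (L - μ) * ‖x - y‖ := by
    refine le_of_sq_le_sq ?_ (by positivity)
    rw [norm_sub_sq_real, real_inner_smul_left, real_inner_smul_right, norm_smul, norm_smul,
      real_inner_comm]
    simp only [mul_pow, Real.norm_eq_abs, sq_abs]
    linarith
  rw [hstep, norm_smul, Real.norm_of_nonneg (by positivity), div_eq_inv_mul, mul_assoc]
  gcongr

end GradientDescent

lemma gradient_eq_zero_of_forall_le {F : Type*} [NormedAddCommGroup F] [InnerProductSpace ℝ F]
    [CompleteSpace F] {f : F → ℝ} {x : F} (h : ∀ y, f x ≤ f y) : gradient f x = 0 := by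
  have hmin : IsLocalMin f x := Eventually.of_forall h
  rw [gradient, hmin.fderiv_eq_zero, map_zero]

/-- A quantizer of dynamic range `1` and error `ε`, rescaled to dynamic range `r`, has error at
most `ε * r`. -/
lemma norm_smul_quantizer_sub_le {F : Type*} [NormedAddCommGroup F] [NormedSpace ℝ F]
    {q : F → F} {ε r : ℝ} (hq : ∀ v, ‖v‖ ≤ 1 → ‖q v - v‖ ≤ ε) (hr : 0 < r) {u : F}
    (hu : ‖u‖ ≤ r) : ‖r • q (r⁻¹ • u) - u‖ ≤ ε * r := by
  have hscaled : ‖r⁻¹ • u‖ ≤ 1 := by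
    rw [norm_smul, Real.norm_of_nonneg (by positivity), inv_mul_le_iff₀ hr, mul_one]
    exact hu
  calc ‖r • q (r⁻¹ • u) - u‖ = ‖r • (q (r⁻¹ • u) - r⁻¹ • u)‖ := by
        rw [smul_sub, smul_inv_smul₀ hr.ne']
    _ = r * ‖q (r⁻¹ • u) - r⁻¹ • u‖ := by rw [norm_smul, Real.norm_of_nonneg hr.le]
    _ ≤ r * ε := by gcongr; exact hq _ hscaled
    _ = ε * r := mul_comm _ _

/-- A sequence bounded by `C * T * M ^ T` has root growth rate at most `M`. -/
lemma limsup_rpow_one_div_le {a : ℕ → ℝ} {C M : ℝ} (ha : ∀ T, 0 ≤ a T) (hC : 0 < C)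
    (hM : 0 ≤ M) (hbound : ∀ T : ℕ, 1 ≤ T → a T ≤ C * T * M ^ T) :
    limsup (fun T : ℕ => a T ^ (1 / (T : ℝ))) atTop ≤ M := by
  have hlim : Tendsto (fun T : ℕ => C ^ (1 / (T : ℝ)) * (T : ℝ) ^ (1 / (T : ℝ)) * M) atTop
      (𝓝 M) := by
    have h₁ : Tendsto (fun T : ℕ => C ^ (1 / (T : ℝ))) atTop (𝓝 1) := by
      simpa [Function.comp_def] using ((Real.continuous_const_rpow hC.ne').tendsto 0).comp
        (tendsto_one_div_atTop_nhds_zero_nat (𝕜 := ℝ))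
    have h₂ := tendsto_rpow_div.comp (tendsto_natCast_atTop_atTop (R := ℝ))
    simpa using (h₁.mul h₂).mul_const M
  rw [← hlim.limsup_eq]
  refine limsup_le_limsup ?_ ?_ hlim.isBoundedUnder_le
  · filter_upwards [eventually_ge_atTop 1] with T hT
    calc a T ^ (1 / (T : ℝ)) ≤ (C * T * M ^ T) ^ (1 / (T : ℝ)) :=
          Real.rpow_le_rpow (ha T) (hbound T hT) (by positivity)
      _ = C ^ (1 / (T : ℝ)) * (T : ℝ) ^ (1 / (T : ℝ)) * M := by
          rw [Real.mul_rpow (by positivity) (by positivity), Real.mul_rpow hC.le (by positivity),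
            one_div, Real.pow_rpow_inv_natCast hM (by omega)]
  · exact (isBoundedUnder_of ⟨0, fun T => Real.rpow_nonneg (ha T) _⟩).isCoboundedUnder_le

/-- Linear contraction factor of DQ-GD (Theorem 1, per-instance form). -/
theorem dqgd_contraction_factor (n : ℕ) (hn : 1 ≤ n)
    (L μ D : ℝ) (hμ : 0 < μ) (hμL : μ ≤ L) (hD : 0 < D)
    (ηGD σGD : ℝ) (hηGD : ηGD = 2 / (L + μ)) (hσGD : σGD = (L - μ) / (L + μ))
    (f : EuclideanSpace ℝ (Fin n) → ℝ) (hf : Differentiable ℝ f)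
    (hsmooth : ∀ x y : EuclideanSpace ℝ (Fin n),
      ‖gradient f x - gradient f y‖ ≤ L * ‖x - y‖)
    (hconv : ConvexOn ℝ Set.univ (fun x : EuclideanSpace ℝ (Fin n) => f x - μ / 2 * ‖x‖ ^ 2))
    (xs : EuclideanSpace ℝ (Fin n)) (hmin : ∀ x, f xs ≤ f x)
    (q : EuclideanSpace ℝ (Fin n) → EuclideanSpace ℝ (Fin n))
    (ε : ℝ) (hε : 0 < ε)
    (hq : ∀ v : EuclideanSpace ℝ (Fin n), ‖v‖ ≤ 1 → ‖q v - v‖ ≤ ε)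
    (xh u e : ℕ → EuclideanSpace ℝ (Fin n)) (r : ℕ → ℝ)
    (hr0 : r 0 = L * D)
    (hr : ∀ t : ℕ, r (t + 1) = σGD ^ (t + 1) * L * D + ε * r t)
    (hu0 : u 0 = gradient f (xh 0))
    (hu : ∀ t : ℕ, u (t + 1) = gradient f (xh (t + 1) + ηGD • e t) - e t)
    (he : ∀ t : ℕ, e t = r t • q ((r t)⁻¹ • u t) - u t)
    (hxh : ∀ t : ℕ, xh (t + 1) = xh t - ηGD • (u t + e t))
    (hinit : ‖xs - xh 0‖ ≤ D) :
    Filter.limsup (fun T : ℕ => ‖xh T - xs‖ ^ (1 / (T : ℝ))) Filter.atTop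
      ≤ max σGD ε := by
  have hL : 0 < L := hμ.trans_le hμL
  have hσ : 0 ≤ σGD := hσGD ▸ div_nonneg (sub_nonneg.2 hμL) (by linarith)
  have hη : 0 < ηGD := hηGD ▸ div_pos two_pos (by linarith)
  have hgrad : gradient f xs = 0 := gradient_eq_zero_of_forall_le hmin
  have hstep (x : EuclideanSpace ℝ (Fin n)) :
      ‖x - ηGD • gradient f x - xs‖ ≤ σGD * ‖x - xs‖ := by
    simpa [hηGD, hσGD, hgrad] using norm_gradient_step_sub_le hμ hμL hf hsmooth hconv x xs
  have hgrad_le (x : EuclideanSpace ℝ (Fin n)) : ‖gradient f x‖ ≤ L * ‖x - xs‖ := by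
    simpa [hgrad] using hsmooth x xs
  have hrpos (t : ℕ) : 0 < r t := by
    induction t with
    | zero => rw [hr0]; positivity
    | succ t ih => rw [hr]; positivity
  have herr (t : ℕ) (h : ‖u t‖ ≤ r t) : ‖e t‖ ≤ ε * r t := by
    rw [he]
    exact norm_smul_quantizer_sub_le hq (hrpos t) h
  -- The compensated iterates follow exact gradient descent.
  obtain ⟨p, hp0, hp⟩ : ∃ p : ℕ → EuclideanSpace ℝ (Fin n), p 0 = 0 ∧ ∀ t, p (t + 1) = e t :=
    ⟨fun t => Nat.casesOn t 0 e, rfl, fun _ => rfl⟩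
  have hup (t : ℕ) : u t = gradient f (xh t + ηGD • p t) - p t := by
    cases t with
    | zero => simp [hu0, hp0]
    | succ t => rw [hu, hp]
  have hdescent (t : ℕ) : xh (t + 1) + ηGD • e t
      = xh t + ηGD • p t - ηGD • gradient f (xh t + ηGD • p t) := by
    rw [hxh, hup]
    module
  have hinv (t : ℕ) : ‖xh t + ηGD • p t - xs‖ ≤ σGD ^ t * D ∧ ‖u t‖ ≤ r t := by
    induction t with
    | zero =>
      have h0 : ‖xh 0 - xs‖ ≤ D := norm_sub_rev xs (xh 0) ▸ hinit
      refine ⟨by simpa [hp0] using h0, ?_⟩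
      rw [hu0, hr0]
      exact (hgrad_le _).trans (by gcongr)
    | succ t ih =>
      have hz : ‖xh (t + 1) + ηGD • e t - xs‖ ≤ σGD ^ (t + 1) * D := by
        rw [hdescent, pow_succ', mul_assoc]
        exact (hstep _).trans (by gcongr; exact ih.1)
      refine ⟨by rwa [hp], ?_⟩
      rw [hu, hr]
      calc ‖gradient f (xh (t + 1) + ηGD • e t) - e t‖
          ≤ ‖gradient f (xh (t + 1) + ηGD • e t)‖ + ‖e t‖ := norm_sub_le _ _
        _ ≤ L * (σGD ^ (t + 1) * D) + ε * r t :=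
          add_le_add ((hgrad_le _).trans (by gcongr)) (herr t ih.2)
        _ = σGD ^ (t + 1) * L * D + ε * r t := by ring
  set M := max σGD ε
  have hσM : σGD ≤ M := le_max_left _ _
  have hεM : ε ≤ M := le_max_right _ _
  have hM0 : 0 ≤ M := hσ.trans hσM
  have hrM (t : ℕ) : r t ≤ (t + 1) * M ^ t * (L * D) := by
    induction t with
    | zero => simp [hr0]
    | succ t ih =>
      calc r (t + 1) = σGD ^ (t + 1) * L * D + ε * r t := hr t
        _ ≤ M ^ (t + 1) * L * D + M * ((t + 1) * M ^ t * (L * D)) := by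
          have := (hrpos t).le
          gcongr
        _ = ((t + 1 : ℕ) + 1) * M ^ (t + 1) * (L * D) := by push_cast; ring
  refine limsup_rpow_one_div_le (C := D + ηGD * (L * D)) (fun T => norm_nonneg _)
    (by positivity) hM0 fun T hT => ?_
  obtain ⟨t, rfl⟩ : ∃ t, T = t + 1 := ⟨T - 1, by omega⟩
  have hz := (hinv (t + 1)).1
  rw [hp] at hz
  have ht : (0 : ℝ) ≤ t := t.cast_nonneg
  calc ‖xh (t + 1) - xs‖ = ‖xh (t + 1) + ηGD • e t - xs - ηGD • e t‖ := by congr 1; abel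
    _ ≤ ‖xh (t + 1) + ηGD • e t - xs‖ + ηGD * ‖e t‖ := by
      refine (norm_sub_le _ _).trans_eq ?_
      rw [norm_smul, Real.norm_of_nonneg hη.le]
    _ ≤ σGD ^ (t + 1) * D + ηGD * (ε * r t) := by
      gcongr
      exact herr t (hinv t).2
    _ ≤ M ^ (t + 1) * D + ηGD * (M * ((t + 1) * M ^ t * (L * D))) := by
      have := (hrpos t).le
      gcongr
      exact hrM t
    _ ≤ (t + 1) * (M ^ (t + 1) * D) + ηGD * (M * ((t + 1) * M ^ t * (L * D))) := by
      have : M ^ (t + 1) * D ≤ (t + 1) * (M ^ (t + 1) * D) :=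
        le_mul_of_one_le_left (by positivity) (by linarith)
      linarith
    _ = (D + ηGD * (L * D)) * (t + 1 : ℕ) * M ^ (t + 1) := by push_cast; ring
end

section
/- DQ-AGD quantization-error bound. Under the DQ-AGD algorithm, assume p(σ_AGD) ≠ 0 where p(s) := s² − ε·(1+γ)·s − ε·γ. Then for every t ≥ 0 one has ‖u_t‖ ≤ r_t and ‖e_t‖ ≤ ε·r_t, and moreover r_t = c_0·σ_AGD^t + c_+·φ_+^t + c_−·φ_−^t, where φ_± := (ε·(1+γ) ± √(ε²·(1+γ)² + 4·ε·γ))/2, c_0 := σ_AGD²·(L·D·λ)/p(σ_AGD), c_+ := −(c_0·φ_+²/σ_AGD²)·(σ_AGD − φ_−)/(φ_+ − φ_−), c_− := (c_0·φ_−²/σ_AGD²)·(σ_AGD − φ_+)/(φ_+ − φ_−). -/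
open scoped RealInnerProductSpace

section InnerProduct

variable {E : Type*} [NormedAddCommGroup E] [InnerProductSpace ℝ E] [CompleteSpace E]

/-- The derivative of a differentiable function along a line, in terms of its gradient. -/
lemma hasDerivAt_comp_line {f : E → ℝ} (hf : Differentiable ℝ f) (x d : E) (s : ℝ) :
    HasDerivAt (fun s : ℝ => f (x + s • d)) ⟪gradient f (x + s • d), d⟫ s := by
  have h1 : HasDerivAt (fun s : ℝ => x + s • d) d s := by
    simpa using ((hasDerivAt_id s).smul_const d).const_add x
  have h2 := (hf (x + s • d)).hasGradientAt.hasFDerivAt.comp_hasDerivAt s h1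
  simpa [Function.comp_def] using h2

/-- Quadratic upper bound for a function with Lipschitz gradient. -/
lemma le_quadratic_of_lipschitz_gradient {f : E → ℝ} (hf : Differentiable ℝ f) {L : ℝ}
    (hL : ∀ x y : E, ‖gradient f x - gradient f y‖ ≤ L * ‖x - y‖) (x y : E) :
    f y ≤ f x + ⟪gradient f x, y - x⟫ + L / 2 * ‖y - x‖ ^ 2 := by
  set d := y - x with hd
  let ψ : ℝ → ℝ := fun s => f (x + s • d) - (s * ⟪gradient f x, d⟫ + s ^ 2 * (L / 2 * ‖d‖ ^ 2))
  have hψ : ∀ s, HasDerivAt ψ (⟪gradient f (x + s • d), d⟫ -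
      (⟪gradient f x, d⟫ + 2 * s * (L / 2 * ‖d‖ ^ 2))) s := by
    intro s
    refine (hasDerivAt_comp_line hf x d s).sub (HasDerivAt.add ?_ ?_)
    · simpa using (hasDerivAt_id s).mul_const ⟪gradient f x, d⟫
    · simpa using (hasDerivAt_pow 2 s).mul_const (L / 2 * ‖d‖ ^ 2)
  have hanti : AntitoneOn ψ (Set.Icc 0 1) := by
    refine antitoneOn_of_deriv_nonpos (convex_Icc 0 1)
      (fun s _ => (hψ s).continuousAt.continuousWithinAt)
      (fun s _ => (hψ s).differentiableAt.differentiableWithinAt) fun s hs => ?_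
    rw [interior_Icc] at hs
    rw [(hψ s).deriv]
    have h1 : ⟪gradient f (x + s • d) - gradient f x, d⟫ ≤ L * ‖s • d‖ * ‖d‖ := by
      refine (real_inner_le_norm _ _).trans ?_
      gcongr
      simpa using hL (x + s • d) x
    rw [inner_sub_left, norm_smul, Real.norm_of_nonneg hs.1.le] at h1
    nlinarith
  have h := hanti (Set.left_mem_Icc.2 zero_le_one) (Set.right_mem_Icc.2 zero_le_one) zero_le_one
  simp only [ψ, zero_smul, one_smul, add_zero, hd, add_sub_cancel] at h
  rw [hd]
  linarith

/-- First-order characterization of strong convexity. -/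
lemma quadratic_le_of_convexOn_sub {f : E → ℝ} (hf : Differentiable ℝ f) {μ : ℝ}
    (hconv : ConvexOn ℝ Set.univ (fun x : E => f x - μ / 2 * ‖x‖ ^ 2)) (x y : E) :
    f x + ⟪gradient f x, y - x⟫ + μ / 2 * ‖y - x‖ ^ 2 ≤ f y := by
  set d := y - x with hd
  let ψ : ℝ → ℝ := fun s => f (x + s • d) - μ / 2 * ‖x + s • d‖ ^ 2
  have hline : HasDerivAt (fun s : ℝ => x + s • d) d 0 := by
    simpa using ((hasDerivAt_id (0 : ℝ)).smul_const d).const_add x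
  have hψ : HasDerivAt ψ (⟪gradient f x, d⟫ - μ / 2 * (2 * ⟪x, d⟫)) 0 := by
    have h1 := hasDerivAt_comp_line hf x d 0
    have h2 := hline.norm_sq.const_mul (μ / 2)
    simp only [zero_smul, add_zero] at h1 h2
    exact h1.sub h2
  have hψc : ConvexOn ℝ Set.univ ψ := by
    have h := hconv.comp_affineMap (AffineMap.lineMap x y : ℝ →ᵃ[ℝ] E)
    have heq : (fun x : E => f x - μ / 2 * ‖x‖ ^ 2) ∘ (AffineMap.lineMap x y : ℝ →ᵃ[ℝ] E) = ψ := by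
      funext s
      simp [ψ, AffineMap.lineMap_apply, hd, add_comm]
    rwa [heq, Set.preimage_univ] at h
  have h := hψc.le_slope_of_hasDerivAt (Set.mem_univ 0) (Set.mem_univ 1) zero_lt_one hψ
  have hy : y = x + d := by simp [hd]
  have hn := norm_add_sq_real x d
  simp only [slope_def_field, ψ, zero_smul, one_smul, add_zero, sub_zero, div_one] at h
  rw [hy]
  linear_combination h - μ / 2 * hn

/-- One step of Nesterov's method contracts the Lyapunov function
`f y - f x* + μ / 2 * ‖v - x*‖ ^ 2`, where `a = √(μ / L)` and `v` is the auxiliary sequence. -/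
lemma nesterov_lyapunov_step {f : E → ℝ} (hf : Differentiable ℝ f) {L μ a : ℝ} (hL : 0 < L)
    (hμ : 0 < μ) (ha : 0 < a) (ha1 : a ≤ 1) (haL : a ^ 2 * L = μ)
    (hsmooth : ∀ x y : E, ‖gradient f x - gradient f y‖ ≤ L * ‖x - y‖)
    (hconv : ConvexOn ℝ Set.univ (fun x : E => f x - μ / 2 * ‖x‖ ^ 2))
    {xs x y y' v v' : E} (hv : a • (v - x) = x - y)
    (hy' : y' = x - (1 / L) • gradient f x)
    (hv' : v' = (1 - a) • v + a • x - (a / μ) • gradient f x) :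
    f y' - f xs + μ / 2 * ‖v' - xs‖ ^ 2 ≤
      (1 - a) * (f y - f xs + μ / 2 * ‖v - xs‖ ^ 2) := by
  set g := gradient f x with hg
  have h1 := le_quadratic_of_lipschitz_gradient hf hsmooth x y'
  have h2 := quadratic_le_of_convexOn_sub hf hconv x xs
  have h3 := quadratic_le_of_convexOn_sub hf hconv x y
  rw [← hg] at h1 h2 h3
  have hy'x : y' - x = -((1 / L) • g) := by rw [hy']; abel
  have h4 : f y' ≤ f x - 1 / (2 * L) * ‖g‖ ^ 2 := by
    rw [hy'x, inner_neg_right, inner_smul_right, real_inner_self_eq_norm_sq, norm_neg, norm_smul,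
      Real.norm_of_nonneg (by positivity)] at h1
    refine h1.trans (le_of_eq ?_)
    field_simp
    ring
  have hv'x : v' - xs = ((1 - a) • (v - xs) + a • (x - xs)) - (a / μ) • g := by
    rw [hv']; module
  have hcvx : ‖(1 - a) • (v - xs) + a • (x - xs)‖ ^ 2 ≤
      (1 - a) * ‖v - xs‖ ^ 2 + a * ‖x - xs‖ ^ 2 := by
    have hsub := norm_sub_sq_real (v - xs) (x - xs)
    rw [norm_add_sq_real, norm_smul, norm_smul, inner_smul_left, inner_smul_right,
      Real.norm_of_nonneg ha.le, Real.norm_of_nonneg (sub_nonneg.2 ha1)]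
    simp only [conj_trivial]
    nlinarith [mul_nonneg (mul_nonneg ha.le (sub_nonneg.2 ha1))
      (sq_nonneg ‖v - xs - (x - xs)‖)]
  have hin : a * ⟪(1 - a) • (v - xs) + a • (x - xs), g⟫ =
      (1 - a) * ⟪g, x - y⟫ + a * ⟪g, x - xs⟫ := by
    have hcomb : a • ((1 - a) • (v - xs) + a • (x - xs)) =
        (1 - a) • (x - y) + a • (x - xs) := by
      rw [← hv]; module
    rw [real_inner_comm, ← inner_smul_right, hcomb, inner_add_right, inner_smul_right,
      inner_smul_right]
  have hexp : μ / 2 * ‖v' - xs‖ ^ 2 =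
      μ / 2 * ‖(1 - a) • (v - xs) + a • (x - xs)‖ ^ 2 -
        a * ⟪(1 - a) • (v - xs) + a • (x - xs), g⟫ + 1 / (2 * L) * ‖g‖ ^ 2 := by
    rw [hv'x, norm_sub_sq_real, inner_smul_right, norm_smul, Real.norm_of_nonneg (by positivity),
      ← haL]
    field_simp
  have hxy : ⟪g, y - x⟫ = -⟪g, x - y⟫ := by rw [← inner_neg_right, neg_sub]
  have hxs : ⟪g, xs - x⟫ = -⟪g, x - xs⟫ := by rw [← inner_neg_right, neg_sub]
  rw [hxs, norm_sub_rev xs x] at h2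
  rw [hxy] at h3
  have h3' : f x - ⟪g, x - y⟫ ≤ f y := by
    have : 0 ≤ μ / 2 * ‖y - x‖ ^ 2 := by positivity
    linarith
  have e1 := mul_le_mul_of_nonneg_left h2 ha.le
  have e2 := mul_le_mul_of_nonneg_left h3' (sub_nonneg.2 ha1)
  have e3 := mul_le_mul_of_nonneg_left hcvx (half_pos hμ).le
  rw [hexp, hin]
  linarith

/-- Linear convergence of the iterates of Nesterov's accelerated gradient method. -/
lemma nesterov_dist_sq_le {f : E → ℝ} (hf : Differentiable ℝ f) {L μ γ k : ℝ}
    (hμ : 0 < μ) (hk : 1 ≤ k) (hkL : k ^ 2 * μ = L) (hγ : γ = (k - 1) / (k + 1))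
    (hsmooth : ∀ x y : E, ‖gradient f x - gradient f y‖ ≤ L * ‖x - y‖)
    (hconv : ConvexOn ℝ Set.univ (fun x : E => f x - μ / 2 * ‖x‖ ^ 2))
    {xs : E} (hgrad : gradient f xs = 0) {x y : ℕ → E} (h0 : y 0 = x 0)
    (hy : ∀ t, y (t + 1) = x t - (1 / L) • gradient f (x t))
    (hx : ∀ t, x (t + 1) = y (t + 1) + γ • (y (t + 1) - y t)) (t : ℕ) :
    ‖y t - xs‖ ^ 2 ≤ (1 - 1 / k) ^ t * ((k ^ 2 + 1) * ‖x 0 - xs‖ ^ 2) := by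
  have hk0 : 0 < k := by linarith
  have hL : 0 < L := by rw [← hkL]; positivity
  let v : ℕ → E := fun t => x t + k • (x t - y t)
  have hlyap : ∀ t, f (y t) - f xs + μ / 2 * ‖v t - xs‖ ^ 2 ≤
      (1 - 1 / k) ^ t * ((L + μ) / 2 * ‖x 0 - xs‖ ^ 2) := by
    intro t
    induction t with
    | zero =>
      have h := le_quadratic_of_lipschitz_gradient hf hsmooth xs (x 0)
      simp only [hgrad, inner_zero_left] at h
      simp only [v, h0, sub_self, smul_zero, add_zero, pow_zero, one_mul]
      linarith
    | succ t ih =>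
      have ha1 : 1 / k ≤ 1 := by rw [div_le_one hk0]; exact hk
      have hstep := nesterov_lyapunov_step (xs := xs) (x := x t) (y := y t) (y' := y (t + 1))
        (v := v t) (v' := v (t + 1)) hf hL hμ (one_div_pos.2 hk0) ha1
        (by rw [← hkL]; field_simp) hsmooth hconv
        (by simp only [v, add_sub_cancel_left, smul_smul]
            rw [one_div_mul_cancel hk0.ne', one_smul])
        (hy t) (by
          have hc : (1 + k) * γ = k - 1 := by rw [hγ]; field_simp; ring
          have e1 : v (t + 1) = y (t + 1) + ((1 + k) * γ) • (y (t + 1) - y t) := by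
            simp only [v, hx]; module
          have e2 : 1 / k / μ = k * (1 / L) := by rw [← hkL]; field_simp
          rw [e1, hc, hy, e2]
          simp only [v]
          match_scalars <;> field_simp <;> ring)
      calc _ ≤ _ := hstep
        _ ≤ (1 - 1 / k) * _ := mul_le_mul_of_nonneg_left ih (sub_nonneg.2 ha1)
        _ = _ := by ring
  have h1 := quadratic_le_of_convexOn_sub hf hconv xs (y t)
  simp only [hgrad, inner_zero_left] at h1
  have h2 : 0 ≤ μ / 2 * ‖v t - xs‖ ^ 2 := by positivity
  have h3 : μ / 2 * ‖y t - xs‖ ^ 2 ≤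
      μ / 2 * ((1 - 1 / k) ^ t * ((k ^ 2 + 1) * ‖x 0 - xs‖ ^ 2)) := by
    calc _ ≤ (1 - 1 / k) ^ t * ((L + μ) / 2 * ‖x 0 - xs‖ ^ 2) := by linarith [hlyap t]
      _ = _ := by rw [← hkL]; ring
  exact le_of_mul_le_mul_left h3 (half_pos hμ)

/-- Linear decay of the gradients along Nesterov's accelerated gradient method. -/
lemma nesterov_norm_gradient_le {f : E → ℝ} (hf : Differentiable ℝ f) {L μ γ k σ D : ℝ}
    (hμ : 0 < μ) (hk : 1 < k) (hkL : k ^ 2 * μ = L) (hγ : γ = (k - 1) / (k + 1))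
    (hσ : σ = Real.sqrt (1 - 1 / k))
    (hsmooth : ∀ x y : E, ‖gradient f x - gradient f y‖ ≤ L * ‖x - y‖)
    (hconv : ConvexOn ℝ Set.univ (fun x : E => f x - μ / 2 * ‖x‖ ^ 2))
    {xs : E} (hgrad : gradient f xs = 0) {x y : ℕ → E} (h0 : y 0 = x 0)
    (hy : ∀ t, y (t + 1) = x t - (1 / L) • gradient f (x t))
    (hx : ∀ t, x (t + 1) = y (t + 1) + γ • (y (t + 1) - y t))
    (hD : ‖x 0 - xs‖ ≤ D) (t : ℕ) :
    ‖gradient f (x t)‖ ≤ σ ^ t * L * D * ((1 + γ + γ / σ) * Real.sqrt (k ^ 2 + 1)) := by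
  have hk0 : 0 < k := by linarith
  have hL : 0 < L := by rw [← hkL]; positivity
  have hD0 : 0 ≤ D := (norm_nonneg _).trans hD
  have hγ0 : 0 ≤ γ := by
    rw [hγ]; exact div_nonneg (by linarith) (by linarith)
  have h1k : 0 < 1 - 1 / k := by
    rw [sub_pos, div_lt_one hk0]; exact hk
  have hσ0 : 0 < σ := by rw [hσ]; exact Real.sqrt_pos.2 h1k
  have hσsq : σ ^ 2 = 1 - 1 / k := by rw [hσ]; exact Real.sq_sqrt h1k.le
  have hyb : ∀ t, ‖y t - xs‖ ≤ σ ^ t * D * Real.sqrt (k ^ 2 + 1) := by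
    intro t
    have h := nesterov_dist_sq_le hf hμ hk.le hkL hγ hsmooth hconv hgrad h0 hy hx t
    refine le_of_sq_le_sq ?_ (by positivity)
    rw [mul_pow, mul_pow, Real.sq_sqrt (by positivity), ← pow_mul, mul_comm t 2, pow_mul, hσsq]
    refine h.trans ?_
    calc _ ≤ (1 - 1 / k) ^ t * ((k ^ 2 + 1) * D ^ 2) := by gcongr
      _ = _ := by ring
  have hxb : ‖x t - xs‖ ≤ σ ^ t * D * ((1 + γ + γ / σ) * Real.sqrt (k ^ 2 + 1)) := by
    cases t with
    | zero =>
      have h := hyb 0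
      rw [h0] at h
      refine h.trans ?_
      gcongr
      have : 0 ≤ γ / σ := by positivity
      exact le_mul_of_one_le_left (Real.sqrt_nonneg _) (by linarith)
    | succ t =>
      have hdec : x (t + 1) - xs = (1 + γ) • (y (t + 1) - xs) - γ • (y t - xs) := by
        rw [hx]; module
      rw [hdec]
      refine (norm_sub_le _ _).trans ?_
      rw [norm_smul, norm_smul, Real.norm_of_nonneg hγ0, Real.norm_of_nonneg (by positivity)]
      calc _ ≤ (1 + γ) * (σ ^ (t + 1) * D * Real.sqrt (k ^ 2 + 1)) +
            γ * (σ ^ t * D * Real.sqrt (k ^ 2 + 1)) := by gcongr <;> apply hyb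
        _ = _ := by field_simp; ring
  have h := hsmooth (x t) xs
  rw [hgrad, sub_zero] at h
  calc _ ≤ _ := h
    _ ≤ L * _ := mul_le_mul_of_nonneg_left hxb hL.le
    _ = _ := by ring

end InnerProduct

/-- Closed form of a second-order linear recurrence with geometric forcing and zero initial
values. -/
lemma linear_recurrence_closed_form {s : ℕ → ℝ} {b c σ B φp φm : ℝ}
    (h0 : s 0 = 0) (h1 : s 1 = 0)
    (hs : ∀ k, s (k + 2) = σ ^ k * B + b * s (k + 1) + c * s k)
    (hφp : φp ^ 2 = b * φp + c) (hφm : φm ^ 2 = b * φm + c) (hne : φp - φm ≠ 0)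
    (hp : σ ^ 2 - b * σ - c ≠ 0) (k : ℕ) :
    s k = B / (σ ^ 2 - b * σ - c) *
      (σ ^ k - (σ - φm) / (φp - φm) * φp ^ k + (σ - φp) / (φp - φm) * φm ^ k) := by
  induction k using Nat.twoStepInduction with
  | zero => rw [h0]; field_simp; ring
  | one => rw [h1]; field_simp; ring
  | more k ih0 ih1 =>
    set A := B / (σ ^ 2 - b * σ - c) with hA
    have hB : B = A * (σ ^ 2 - b * σ - c) := by rw [hA, div_mul_cancel₀ _ hp]
    rw [hs, ih0, ih1, pow_add φp k 2, pow_add φm k 2, hφp, hφm]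
    nth_rewrite 1 [hB]
    ring


/-- DQ-AGD quantization-error bound. -/
theorem dqagd_quantization_error (n : ℕ) (hn : 1 ≤ n)
    (L μ D : ℝ) (hμ : 0 < μ) (hμL : μ < L) (hD : 0 < D)
    (κ η γ σAGD lam : ℝ)
    (hκ : κ = L / μ) (hη : η = 1 / L)
    (hγ : γ = (Real.sqrt κ - 1) / (Real.sqrt κ + 1))
    (hσ : σAGD = Real.sqrt (1 - 1 / Real.sqrt κ))
    (hlam : lam = (1 + γ + γ / σAGD) * Real.sqrt (κ + 1))
    (f : EuclideanSpace ℝ (Fin n) → ℝ) (hf : Differentiable ℝ f)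
    (hsmooth : ∀ x y : EuclideanSpace ℝ (Fin n),
      ‖gradient f x - gradient f y‖ ≤ L * ‖x - y‖)
    (hconv : ConvexOn ℝ Set.univ (fun x : EuclideanSpace ℝ (Fin n) => f x - μ / 2 * ‖x‖ ^ 2))
    (xs : EuclideanSpace ℝ (Fin n)) (hmin : ∀ x, f xs ≤ f x)
    (q : EuclideanSpace ℝ (Fin n) → EuclideanSpace ℝ (Fin n))
    (ε : ℝ) (hε : 0 < ε)
    (hq : ∀ v : EuclideanSpace ℝ (Fin n), ‖v‖ ≤ 1 → ‖q v - v‖ ≤ ε)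
    (xh yh u : ℕ → EuclideanSpace ℝ (Fin n))
    (e : ℤ → EuclideanSpace ℝ (Fin n)) (r : ℤ → ℝ)
    (he1 : e (-1) = 0) (he2 : e (-2) = 0) (hyh0 : yh 0 = xh 0)
    (hr1 : r (-1) = 0) (hr2 : r (-2) = 0)
    (hrrec : ∀ t : ℕ, r (t : ℤ) = σAGD ^ t * L * D * lam
      + ε * (r ((t : ℤ) - 1) + γ * (r ((t : ℤ) - 1) + r ((t : ℤ) - 2))))
    (m : ℕ → EuclideanSpace ℝ (Fin n))
    (hm : ∀ t : ℕ, m t = e ((t : ℤ) - 1) + γ • (e ((t : ℤ) - 1) - e ((t : ℤ) - 2)))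
    (hu : ∀ t : ℕ, u t = gradient f (xh t + η • m t) - m t)
    (he : ∀ t : ℕ, e (t : ℤ) = r (t : ℤ) • q ((r (t : ℤ))⁻¹ • u t) - u t)
    (hyh : ∀ t : ℕ, yh (t + 1) = xh t - η • (u t + e (t : ℤ)))
    (hxh : ∀ t : ℕ, xh (t + 1) = yh (t + 1) + γ • (yh (t + 1) - yh t))
    (hinit : ‖xs - xh 0‖ ≤ D)
    (φp φm : ℝ)
    (hφp : φp = (ε * (1 + γ) + Real.sqrt (ε ^ 2 * (1 + γ) ^ 2 + 4 * ε * γ)) / 2)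
    (hφm : φm = (ε * (1 + γ) - Real.sqrt (ε ^ 2 * (1 + γ) ^ 2 + 4 * ε * γ)) / 2)
    (hp : σAGD ^ 2 - ε * (1 + γ) * σAGD - ε * γ ≠ 0)
    (c0 cp cm : ℝ)
    (hc0 : c0 = σAGD ^ 2 * (L * D * lam) / (σAGD ^ 2 - ε * (1 + γ) * σAGD - ε * γ))
    (hcp : cp = -(c0 * φp ^ 2 / σAGD ^ 2) * (σAGD - φm) / (φp - φm))
    (hcm : cm = (c0 * φm ^ 2 / σAGD ^ 2) * (σAGD - φp) / (φp - φm)) :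
    ∀ t : ℕ, ‖u t‖ ≤ r (t : ℤ) ∧ ‖e (t : ℤ)‖ ≤ ε * r (t : ℤ) ∧
      r (t : ℤ) = c0 * σAGD ^ t + cp * φp ^ t + cm * φm ^ t := by
  have hL : 0 < L := hμ.trans hμL
  have hκ1 : 1 < κ := by rw [hκ, one_lt_div hμ]; exact hμL
  have hκ0 : 0 < κ := by linarith
  have hk1 : 1 < Real.sqrt κ := by rw [Real.lt_sqrt zero_le_one]; simpa using hκ1
  have hksq : Real.sqrt κ ^ 2 = κ := Real.sq_sqrt hκ0.le
  have hkL : Real.sqrt κ ^ 2 * μ = L := by rw [hksq, hκ]; field_simp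
  have hγ0 : 0 < γ := by rw [hγ]; exact div_pos (by linarith) (by linarith)
  have hσ0 : 0 < σAGD := by
    rw [hσ, Real.sqrt_pos, sub_pos, div_lt_one (by linarith)]
    exact hk1
  have hlam0 : 0 < lam := by rw [hlam]; positivity
  have hgrad : gradient f xs = 0 := by
    have h : fderiv ℝ f xs = 0 := IsLocalMin.fderiv_eq_zero (Filter.Eventually.of_forall hmin)
    simp [gradient, h]
  have hgb : ∀ t : ℕ, ‖gradient f (xh t + η • m t)‖ ≤ σAGD ^ t * L * D * lam := by
    intro t
    have hm0 : m 0 = 0 := by simp [hm, he1, he2]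
    rw [hlam, ← hksq]
    refine nesterov_norm_gradient_le (x := fun t => xh t + η • m t)
      (y := fun t => yh t + η • e ((t : ℤ) - 1)) hf hμ hk1 hkL hγ hσ hsmooth hconv hgrad
      (by simp [hm0, he1, hyh0]) (fun t => ?_) (fun t => ?_)
      (by simpa [hm0, norm_sub_rev] using hinit) t
    · have hc : ((t + 1 : ℕ) : ℤ) - 1 = t := by push_cast; ring
      simp only [hc, hyh, hu, ← hη]
      module
    · have hc : ((t + 1 : ℕ) : ℤ) - 1 = t := by push_cast; ring
      have hc2 : ((t + 1 : ℕ) : ℤ) - 2 = t - 1 := by push_cast; ring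
      simp only [hxh, hm, hc, hc2]
      module
  have hstep : ∀ t : ℕ, (‖e ((t : ℤ) - 1)‖ ≤ ε * r ((t : ℤ) - 1) ∧ 0 ≤ r ((t : ℤ) - 1)) →
      (‖e ((t : ℤ) - 2)‖ ≤ ε * r ((t : ℤ) - 2) ∧ 0 ≤ r ((t : ℤ) - 2)) →
      ‖u t‖ ≤ r t ∧ ‖e t‖ ≤ ε * r t ∧ 0 ≤ r t := by
    rintro t ⟨hea, hra⟩ ⟨heb, hrb⟩
    have hrt : 0 < r t := by rw [hrrec]; positivity
    have hmb : ‖m t‖ ≤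
        ε * (r ((t : ℤ) - 1) + γ * (r ((t : ℤ) - 1) + r ((t : ℤ) - 2))) := by
      rw [hm]
      calc _ ≤ ‖e ((t : ℤ) - 1)‖ + ‖γ • (e ((t : ℤ) - 1) - e ((t : ℤ) - 2))‖ := norm_add_le _ _
        _ ≤ ‖e ((t : ℤ) - 1)‖ + γ * (‖e ((t : ℤ) - 1)‖ + ‖e ((t : ℤ) - 2)‖) := by
          rw [norm_smul, Real.norm_of_nonneg hγ0.le]
          gcongr
          exact norm_sub_le _ _
        _ ≤ ε * r ((t : ℤ) - 1) + γ * (ε * r ((t : ℤ) - 1) + ε * r ((t : ℤ) - 2)) := by gcongr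
        _ = _ := by ring
    have hut : ‖u t‖ ≤ r t := by
      rw [hu, hrrec]
      exact (norm_sub_le _ _).trans (add_le_add (hgb t) hmb)
    refine ⟨hut, ?_, hrt.le⟩
    have hscale : ‖(r t)⁻¹ • u t‖ ≤ 1 := by
      rw [norm_smul, Real.norm_of_nonneg (inv_nonneg.2 hrt.le), inv_mul_le_one₀ hrt]
      exact hut
    have het : e t = r t • (q ((r t)⁻¹ • u t) - (r t)⁻¹ • u t) := by
      rw [he, smul_sub, smul_smul, mul_inv_cancel₀ hrt.ne', one_smul]
    rw [het, norm_smul, Real.norm_of_nonneg hrt.le, mul_comm ε]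
    exact mul_le_mul_of_nonneg_left (hq _ hscale) hrt.le
  have hshift : ∀ k : ℕ, ((k + 1 : ℕ) : ℤ) - 2 = (k : ℤ) - 1 ∧ ((k + 2 : ℕ) : ℤ) - 2 = k :=
    fun k => ⟨by push_cast; ring, by push_cast; ring⟩
  have hinv : ∀ k : ℕ, ‖e ((k : ℤ) - 2)‖ ≤ ε * r ((k : ℤ) - 2) ∧ 0 ≤ r ((k : ℤ) - 2) := by
    intro k
    induction k using Nat.twoStepInduction with
    | zero => simp [he2, hr2]
    | one => simp [he1, hr1]
    | more k ih0 ih1 =>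
      rw [(hshift k).1] at ih1
      rw [(hshift k).2]
      exact (hstep k ih1 ih0).2
  intro t
  have hprev := hinv (t + 1)
  rw [(hshift t).1] at hprev
  obtain ⟨hut, het, -⟩ := hstep t hprev (hinv t)
  refine ⟨hut, het, ?_⟩
  have hdisc : 0 < ε ^ 2 * (1 + γ) ^ 2 + 4 * ε * γ := by positivity
  have hsq := Real.sq_sqrt hdisc.le
  have hcf := linear_recurrence_closed_form (s := fun k : ℕ => r ((k : ℤ) - 2))
    (b := ε * (1 + γ)) (c := ε * γ) (σ := σAGD) (B := L * D * lam) (φp := φp) (φm := φm)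
    (by simp [hr2]) (by simp [hr1])
    (fun k => by
      simp only [(hshift k).1, (hshift k).2]
      rw [hrrec]
      ring)
    (by rw [hφp]; linear_combination hsq / 4) (by rw [hφm]; linear_combination hsq / 4)
    (sub_pos.2 (by rw [hφp, hφm]; linarith [Real.sqrt_pos.2 hdisc])).ne'
    hp (t + 2)
  simp only [(hshift t).2] at hcf
  rw [hcf, hcp, hcm, hc0]
  have hσne := hσ0.ne'
  set p := σAGD ^ 2 - ε * (1 + γ) * σAGD - ε * γ
  field_simp
  ring
end
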